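/- Under assumptions (*) on k and the condition ∫₁^∞ ds/(s·Φ(s)) < ∞, where Φ(p) = p𝒦(p) and 𝒦 is the Laplace transform of k, the solution u_λ of (D_{(k)} u)(t) = λu(t), u(0)=1 (λ > 0) satisfies u_λ(t) = (λ/(Φ'(p₀(λ))·p₀(λ))) e^{p₀(λ)t} + o(e^{p₀(λ)t}) as t → ∞, where p₀(λ) is the unique positive solution of Φ(p₀) = λ. -/

import Mathlib

open Set MeasureTheory Real Filter Asymptotics

/-- The general fractional (convolutional) derivative
D_{(k)} u (t) = d/dt ∫₀^t k(t−τ)u(τ)dτ − k(t)u(0). -/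
noncomputable def genFracDeriv (k u : ℝ → ℝ) (t : ℝ) : ℝ :=
  deriv (fun r => ∫ τ in (0:ℝ)..r, k (r - τ) * u τ) t - k t * u 0


/-- Uniqueness of the Laplace transform. -/
lemma aux_laplace_unique (f g : ℝ → ℝ) (hf0 : ∀ t > 0, 0 ≤ f t) (hg0 : ∀ t > 0, 0 ≤ g t)
    (hf : ∀ p > 0, IntegrableOn (fun t => Real.exp (-p * t) * f t) (Ioi 0))
    (hg : ∀ p > 0, IntegrableOn (fun t => Real.exp (-p * t) * g t) (Ioi 0))
    (h : ∀ p > 0, ∫ t in Ioi (0:ℝ), Real.exp (-p * t) * f t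
      = ∫ t in Ioi (0:ℝ), Real.exp (-p * t) * g t) :
    f =ᵐ[volume.restrict (Ioi 0)] g := by
  set ν : Measure ℝ := volume.restrict (Ioi 0) with hν
  let D : (ℝ → ℝ) → ℝ → ENNReal := fun f t => ENNReal.ofReal (Real.exp (-1 * t) * f t)
  have key : ∀ f : ℝ → ℝ, (∀ t > 0, 0 ≤ f t) →
      (∀ p > 0, IntegrableOn (fun t => Real.exp (-p * t) * f t) (Ioi 0)) →
      AEMeasurable (D f) ν ∧ IsFiniteMeasure (ν.withDensity (D f)) ∧
      (∫⁻ x, D f x ∂ν ≠ ⊤) ∧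
      (∀ x < 1, x ∈ ProbabilityTheory.integrableExpSet id (ν.withDensity (D f))) ∧
      (∀ x < 1, ProbabilityTheory.mgf id (ν.withDensity (D f)) x
        = ∫ t in Ioi (0:ℝ), Real.exp (-(1 - x) * t) * f t) := by
    intro f hf0 hf
    have hm : AEMeasurable (D f) ν := (hf 1 one_pos).aestronglyMeasurable.aemeasurable.ennreal_ofReal
    have hfin : ∫⁻ x, D f x ∂ν ≠ ⊤ := by
      have := (hf 1 one_pos).lintegral_lt_top
      exact this.ne
    have hlt : ∀ᵐ x ∂ν, D f x < ⊤ := by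
      refine Eventually.of_forall fun x => ENNReal.ofReal_lt_top
    have heq : ∀ x : ℝ, (fun t => (D f t).toReal • Real.exp (x * id t)) =ᵐ[ν]
        fun t => Real.exp (-(1 - x) * t) * f t := by
      intro x
      filter_upwards [ae_restrict_mem measurableSet_Ioi] with t ht
      have : 0 ≤ Real.exp (-1 * t) * f t := mul_nonneg (Real.exp_pos _).le (hf0 t ht)
      simp only [D, ENNReal.toReal_ofReal this, smul_eq_mul, id]
      rw [show -(1 - x) * t = -1 * t + x * t by ring, Real.exp_add]; ring
    refine ⟨hm, isFiniteMeasure_withDensity hfin, hfin, ?_, ?_⟩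
    · intro x hx
      show Integrable (fun ω => Real.exp (x * id ω)) _
      rw [integrable_withDensity_iff_integrable_smul₀' hm hlt]
      exact (hf (1 - x) (by linarith)).congr (heq x).symm
    · intro x hx
      rw [ProbabilityTheory.mgf, integral_withDensity_eq_integral_toReal_smul₀ hm hlt]
      exact integral_congr_ae (heq x)
  obtain ⟨f1, f2, f3, f4, f5⟩ := key f hf0 hf
  obtain ⟨g1, g2, g3, g4, g5⟩ := key g hg0 hg
  have hsub : ∀ μ : Measure ℝ, (∀ x < 1, x ∈ ProbabilityTheory.integrableExpSet id μ) →
      {z : ℂ | z.re < 1} ⊆ {z | z.re ∈ interior (ProbabilityTheory.integrableExpSet id μ)} := by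
    intro μ hμ z hz
    exact mem_interior.2 ⟨Iio 1, fun x hx => hμ x hx, isOpen_Iio, hz⟩
  have hEq : EqOn (ProbabilityTheory.complexMGF id (ν.withDensity (D f)))
      (ProbabilityTheory.complexMGF id (ν.withDensity (D g))) {z : ℂ | z.re < 1} := by
    refine AnalyticOnNhd.eqOn_of_preconnected_of_frequently_eq
      (ProbabilityTheory.analyticOnNhd_complexMGF.mono (hsub _ f4))
      (ProbabilityTheory.analyticOnNhd_complexMGF.mono (hsub _ g4))
      ((convex_Iio (1:ℝ)).linear_preimage Complex.reLm).isPreconnected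
      (z₀ := ((0:ℝ) : ℂ)) (by simp) ?_
    have h_real : ∃ᶠ (x : ℝ) in nhdsWithin 0 {0}ᶜ,
        ProbabilityTheory.complexMGF id (ν.withDensity (D f)) x
          = ProbabilityTheory.complexMGF id (ν.withDensity (D g)) x := by
      refine Eventually.frequently ?_
      have : ∀ᶠ x : ℝ in nhds 0, x < 1 := eventually_lt_nhds one_pos
      filter_upwards [nhdsWithin_le_nhds this] with y hy
      rw [ProbabilityTheory.complexMGF_ofReal, ProbabilityTheory.complexMGF_ofReal,
        f5 y hy, g5 y hy, h _ (by linarith)]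
    rw [frequently_iff_seq_forall] at h_real ⊢
    obtain ⟨xs, hx_tendsto, hx_eq⟩ := h_real
    refine ⟨fun n ↦ xs n, ?_, fun n ↦ ?_⟩
    · rw [tendsto_nhdsWithin_iff] at hx_tendsto ⊢
      constructor
      · exact (Complex.continuous_ofReal.tendsto 0).comp hx_tendsto.1
      · simpa using hx_tendsto.2
    · simp [hx_eq]
  have hmeas : ν.withDensity (D f) = ν.withDensity (D g) := by
    apply Measure.ext_of_charFun
    ext t
    rw [← ProbabilityTheory.complexMGF_id_mul_I, ← ProbabilityTheory.complexMGF_id_mul_I]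
    exact hEq (by simp)
  rw [withDensity_eq_iff f1 g1 f3] at hmeas
  filter_upwards [hmeas, ae_restrict_mem measurableSet_Ioi] with t ht ht0
  have h1 : 0 ≤ Real.exp (-1 * t) * f t := mul_nonneg (Real.exp_pos _).le (hf0 t ht0)
  have h2 : 0 ≤ Real.exp (-1 * t) * g t := mul_nonneg (Real.exp_pos _).le (hg0 t ht0)
  simp only [D] at ht
  rw [ENNReal.ofReal_eq_ofReal_iff h1 h2] at ht
  exact mul_left_cancel₀ (Real.exp_pos _).ne' ht

/-- One-sided convolution. -/
noncomputable def auxConv (m v : ℝ → ℝ) (t : ℝ) : ℝ := ∫ s in (0:ℝ)..t, m (t - s) * v s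

lemma auxConv_comm (m v : ℝ → ℝ) (t : ℝ) : auxConv m v t = auxConv v m t := by
  unfold auxConv
  have := intervalIntegral.integral_comp_sub_left (fun s => v (t - s) * m s) t (a := 0) (b := t)
  simp only [sub_sub_cancel, sub_self, sub_zero] at this
  rw [← this]
  congr 1; ext s; ring

lemma auxConv_integral (m v : ℝ → ℝ) (t : ℝ) (ht : 0 ≤ t)
    (hm : IntegrableOn m (Ioc 0 t)) (hv : IntegrableOn v (Ioc 0 t)) :
    ∫ s in (0:ℝ)..t, auxConv m v s = auxConv (fun x => ∫ r in (0:ℝ)..x, m r) v t := by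
  set m0 := (Ioc 0 t).indicator m with hm0
  set v0 := (Ioc 0 t).indicator v with hv0
  have im : Integrable m0 := (integrable_indicator_iff measurableSet_Ioc).2 hm
  have iv : Integrable v0 := (integrable_indicator_iff measurableSet_Ioc).2 hv
  have I := iv.convolution_integrand (ContinuousLinearMap.mul ℝ ℝ) im
  simp only [ContinuousLinearMap.mul_apply'] at I
  have hsw := intervalIntegral_intervalIntegral_swap (a := 0) (b := t) (c := 0) (d := t)
    (F := fun s r => v0 r * m0 (s - r)) (by
      have := I.integrableOn (s := uIoc 0 t ×ˢ uIoc 0 t)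
      exact this)
  have e1 : ∫ s in (0:ℝ)..t, auxConv m v s
      = ∫ s in (0:ℝ)..t, ∫ r in (0:ℝ)..t, v0 r * m0 (s - r) := by
    refine intervalIntegral.integral_congr fun s hs => ?_
    rw [uIcc_of_le ht] at hs
    unfold auxConv
    rw [intervalIntegral.integral_of_le hs.1, intervalIntegral.integral_of_le ht,
      ← integral_indicator measurableSet_Ioc, ← integral_indicator measurableSet_Ioc]
    refine integral_congr_ae ?_
    have : ∀ᵐ r : ℝ, r ≠ s := by
      simp [ae_iff, measure_singleton]
    filter_upwards [this] with r hr
    by_cases h0 : 0 < r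
    · by_cases h1 : r < s
      · have a1 : r ∈ Ioc 0 s := ⟨h0, h1.le⟩
        have a2 : r ∈ Ioc 0 t := ⟨h0, h1.le.trans hs.2⟩
        have a3 : s - r ∈ Ioc 0 t := ⟨by linarith, by linarith [hs.2]⟩
        simp [hm0, hv0, a1, a2, a3, indicator_of_mem, -mem_Ioc, mul_comm]
      · have h2 : s < r := lt_of_le_of_ne (not_lt.1 h1) (Ne.symm hr)
        have a1 : r ∉ Ioc 0 s := fun h => by linarith [h.2]
        have a3 : s - r ∉ Ioc 0 t := fun h => by linarith [h.1]
        simp [hm0, a1, a3, -mem_Ioc, indicator_apply]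
    · have a1 : r ∉ Ioc 0 s := fun h => h0 h.1
      have a2 : r ∉ Ioc 0 t := fun h => h0 h.1
      simp [a1, a2, -mem_Ioc]
  rw [e1, hsw]
  unfold auxConv
  refine intervalIntegral.integral_congr_ae (Eventually.of_forall fun r hr => ?_)
  rw [uIoc_of_le ht] at hr
  rw [intervalIntegral.integral_const_mul, hv0, indicator_of_mem hr, mul_comm]
  congr 1
  rw [intervalIntegral.integral_comp_sub_right (fun x => m0 x) r]
  have : IntervalIntegrable m0 volume (0 - r) 0 := im.intervalIntegrable
  rw [← intervalIntegral.integral_add_adjacent_intervals this im.intervalIntegrable]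
  have z : ∫ x in (0 - r)..0, m0 x = 0 := by
    rw [intervalIntegral.integral_zero_ae]
    refine Eventually.of_forall fun x hx => ?_
    rw [uIoc_of_le (by linarith [hr.1])] at hx
    exact indicator_of_notMem (fun h => by linarith [h.1, hx.2]) _
  rw [z, zero_add]
  refine intervalIntegral.integral_congr_ae (Eventually.of_forall fun x hx => ?_)
  rw [uIoc_of_le (by linarith [hr.2])] at hx
  exact indicator_of_mem (show x ∈ Ioc 0 t from ⟨hx.1, by linarith [hx.2, hr.1]⟩) _

lemma auxConv_integral' (m v : ℝ → ℝ) (t : ℝ) (ht : 0 ≤ t)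
    (hm : IntegrableOn m (Ioc 0 t)) (hv : IntegrableOn v (Ioc 0 t)) :
    ∫ s in (0:ℝ)..t, auxConv m v s = auxConv m (fun x => ∫ r in (0:ℝ)..x, v r) t := by
  rw [auxConv_comm m, ← auxConv_integral v m t ht hv hm]
  congr 1; ext s; rw [auxConv_comm]

lemma aux_ii (m : ℝ → ℝ) (hint : ∀ t, IntegrableOn m (Ioc 0 t)) (a b t : ℝ)
    (ha : 0 ≤ a) (hab : a ≤ b) (hb : b ≤ t) :
    IntervalIntegrable (fun s => m (t - s)) volume a b := by
  have h1 : IntervalIntegrable m volume 0 t :=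
    (intervalIntegrable_iff_integrableOn_Ioc_of_le (by linarith)).2 (hint t)
  have h2 := h1.comp_sub_left t
  simp only [sub_zero, sub_self] at h2
  refine h2.symm.mono_set ?_
  rw [uIcc_of_le hab, uIcc_of_le (by linarith)]
  exact Icc_subset_Icc ha hb

lemma aux_mii (m : ℝ → ℝ) (hint : ∀ t, IntegrableOn m (Ioc 0 t)) (a b : ℝ)
    (ha : 0 ≤ a) (hb : 0 ≤ b) :
    IntervalIntegrable m volume a b := by
  have h1 : IntervalIntegrable m volume 0 (max a b) :=
    (intervalIntegrable_iff_integrableOn_Ioc_of_le (by positivity)).2 (hint _)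
  refine h1.mono_set ?_
  rw [uIcc_of_le (by positivity : 0 ≤ max a b), uIcc]
  exact Icc_subset_Icc (by positivity) le_rfl

lemma aux_prim_tendsto (m : ℝ → ℝ) (hint : ∀ t, IntegrableOn m (Ioc 0 t)) :
    Tendsto (fun h => ∫ x in (0:ℝ)..h, m x) (nhdsWithin 0 (Ioi 0)) (nhds 0) := by
  have h1 : ContinuousOn (fun h => ∫ x in (0:ℝ)..h, m x) (uIcc 0 1) := by
    apply intervalIntegral.continuousOn_primitive_interval
    rw [uIcc_of_le zero_le_one, integrableOn_Icc_iff_integrableOn_Ioc]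
    exact hint 1
  have h2 := h1 0 (by simp)
  rw [ContinuousWithinAt, intervalIntegral.integral_same, uIcc_of_le zero_le_one] at h2
  refine h2.mono_left ?_
  rw [nhdsWithin_le_iff]
  exact mem_of_superset (Ioc_mem_nhdsGT one_pos) Ioc_subset_Icc_self

lemma aux_mp_lip (m w : ℝ → ℝ) (T L : ℝ) (hpos : ∀ t > 0, 0 < m t)
    (hanti : AntitoneOn m (Ioi 0)) (hint : ∀ t, IntegrableOn m (Ioc 0 t))
    (hw : Continuous w)
    (hL : ∀ x y, 0 ≤ x → x ≤ y → y ≤ T → w x - w y ≤ L * (y - x)) (hL0 : 0 ≤ L)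
    (hw0 : 0 ≤ w 0) (hmono : MonotoneOn (auxConv m w) (Icc 0 T)) :
    ∀ t ∈ Icc 0 T, 0 ≤ w t := by
  by_contra hcon
  push Not at hcon
  obtain ⟨t1, ht1, hneg⟩ := hcon
  obtain ⟨t, ht, hmin⟩ := isCompact_Icc.exists_isMinOn ⟨t1, ht1⟩ hw.continuousOn
  have hmin' : ∀ s ∈ Icc 0 T, w t ≤ w s := fun s hs => hmin hs
  have hwt : w t < 0 := (hmin' t1 ht1).trans_lt hneg
  have ht0 : 0 < t := lt_of_le_of_ne ht.1 (by rintro rfl; linarith)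
  have key : ∀ h, 0 < h → h < t → (-w t) * m t ≤ L * ∫ x in (0:ℝ)..h, m x := by
    intro h hh hht
    set a := t - h with ha
    have ha0 : 0 < a := by linarith
    have hat : a ≤ t := by linarith
    have hm0 : auxConv m w a ≤ auxConv m w t :=
      hmono ⟨ha0.le, by linarith [ht.2]⟩ ht hat
    have i1 := aux_ii m hint 0 a t le_rfl ha0.le hat
    have i2 := aux_ii m hint 0 a a le_rfl ha0.le le_rfl
    have i3 := aux_ii m hint a t t ha0.le hat le_rfl
    have e1 : auxConv m w t = (∫ s in (0:ℝ)..a, m (t - s) * w s) + ∫ s in a..t, m (t - s) * w s :=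
      (intervalIntegral.integral_add_adjacent_intervals (i1.mul_continuousOn hw.continuousOn)
        (i3.mul_continuousOn hw.continuousOn)).symm
    have b1 : (∫ s in (0:ℝ)..a, m (t - s) * w s) - auxConv m w a
        ≤ ∫ s in (0:ℝ)..a, (m (t - s) - m (a - s)) * w t := by
      unfold auxConv
      rw [← intervalIntegral.integral_sub (i1.mul_continuousOn hw.continuousOn)
        (i2.mul_continuousOn hw.continuousOn)]
      refine intervalIntegral.integral_mono_on_of_le_Ioo ha0.le
        ((i1.mul_continuousOn hw.continuousOn).sub (i2.mul_continuousOn hw.continuousOn))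
        ((i1.sub i2).mul_const _) ?_
      intro s hs
      have h1 : m (t - s) ≤ m (a - s) :=
        hanti (show 0 < a - s by linarith [hs.2]) (show 0 < t - s by linarith [hs.2]) (by linarith)
      have h2 := hmin' s ⟨hs.1.le, by linarith [hs.2, ht.2]⟩
      nlinarith
    have b2 : ∫ s in a..t, m (t - s) * w s ≤ ∫ s in a..t, m (t - s) * (w t + L * h) := by
      refine intervalIntegral.integral_mono_on_of_le_Ioo hat
        (i3.mul_continuousOn hw.continuousOn) (i3.mul_const _) ?_
      intro s hs
      have h1 : 0 < m (t - s) := hpos _ (by linarith [hs.2])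
      have h2 := hL s t (by linarith [hs.1]) hs.2.le ht.2
      have h3 : L * (t - s) ≤ L * h := mul_le_mul_of_nonneg_left (by linarith [hs.1]) hL0
      exact mul_le_mul_of_nonneg_left (by linarith) h1.le
    rw [intervalIntegral.integral_mul_const, intervalIntegral.integral_sub i1 i2,
      intervalIntegral.integral_comp_sub_left (fun x => m x) t,
      intervalIntegral.integral_comp_sub_left (fun x => m x) a] at b1
    rw [intervalIntegral.integral_mul_const,
      intervalIntegral.integral_comp_sub_left (fun x => m x) t] at b2
    simp only [sub_self, sub_zero] at b1 b2
    have hta : t - a = h := by simp [ha]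
    rw [hta] at b1 b2
    have s1 := intervalIntegral.integral_add_adjacent_intervals (aux_mii m hint 0 h le_rfl hh.le)
      (aux_mii m hint h t hh.le ht0.le)
    have s2 := intervalIntegral.integral_add_adjacent_intervals (aux_mii m hint 0 a le_rfl ha0.le)
      (aux_mii m hint a t ha0.le ht0.le)
    have b3 : h * m t ≤ ∫ x in a..t, m x := by
      have : ∫ x in a..t, m t ≤ ∫ x in a..t, m x := by
        refine intervalIntegral.integral_mono_on hat intervalIntegrable_const
          (aux_mii m hint a t ha0.le ht0.le) ?_
        intro x hx
        exact hanti (show 0 < x by linarith [hx.1]) ht0 hx.2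
      rwa [intervalIntegral.integral_const, smul_eq_mul, hta] at this
    set A := ∫ x in (0:ℝ)..h, m x
    set B := ∫ x in h..t, m x
    set C := ∫ x in (0:ℝ)..a, m x
    set D := ∫ x in a..t, m x
    have hBC : B - C = D - A := by linarith
    rw [hBC] at b1
    have f1 : 0 ≤ D * w t + L * h * A := by nlinarith
    have f2 : D * w t ≤ h * m t * w t := by nlinarith
    have f3 : 0 ≤ h * (m t * w t + L * A) := by nlinarith
    have := nonneg_of_mul_nonneg_right f3 hh
    linarith
  have hlim : Tendsto (fun h => L * ∫ x in (0:ℝ)..h, m x) (nhdsWithin 0 (Ioi 0)) (nhds (L * 0)) :=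
    (aux_prim_tendsto m hint).const_mul L
  have := ge_of_tendsto hlim (b := (-w t) * m t) (by
    filter_upwards [Ioo_mem_nhdsGT ht0] with h hh
    exact key h hh.1 hh.2)
  have h2 := hpos t ht0
  nlinarith

lemma aux_mp (m v : ℝ → ℝ) (T : ℝ) (hpos : ∀ t > 0, 0 < m t)
    (hanti : AntitoneOn m (Ioi 0)) (hint : ∀ t, IntegrableOn m (Ioc 0 t))
    (hv : Continuous v) (hmono : MonotoneOn (auxConv m v) (Icc 0 T)) :
    ∀ t ∈ Ioc 0 T, 0 ≤ v t := by
  intro t0 ht0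
  by_contra hneg
  push Not at hneg
  have hT : 0 < T := ht0.1.trans_le ht0.2
  -- an interval on which `v` is negative
  obtain ⟨ε, hε0, hεt, hε⟩ : ∃ ε > 0, ε < t0 ∧ ∀ s ∈ Icc (t0 - ε) t0, v s < 0 := by
    obtain ⟨δ, hδ, hb⟩ := Metric.mem_nhds_iff.1 (hv.continuousAt.eventually_lt_const hneg)
    refine ⟨min (δ / 2) (t0 / 2), by have := ht0.1; positivity, ?_, ?_⟩
    · exact (min_le_right _ _).trans_lt (by linarith [ht0.1])
    · intro s hs
      apply hb
      rw [Metric.mem_ball, Real.dist_eq, abs_lt]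
      have := min_le_left (δ / 2) (t0 / 2)
      constructor <;> linarith [hs.1, hs.2]
  set v0 : ℝ → ℝ := (Ioi 0).indicator v with hv0
  have hv0neg : ∀ s ≤ 0, v0 s = 0 := fun s hs => indicator_of_notMem (by simpa using hs) _
  have hv0pos : ∀ s > 0, v0 s = v s := fun s hs => indicator_of_mem (by simpa using hs) _
  have hvint : ∀ a b, IntervalIntegrable v0 volume a b := by
    intro a b
    have := hv.intervalIntegrable (μ := volume) a b
    rw [intervalIntegrable_iff] at this ⊢
    exact this.indicator measurableSet_Ioi
  set I : ℝ → ℝ := fun t => ∫ s in (0:ℝ)..t, v0 s with hI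
  have hIc : Continuous I := intervalIntegral.continuous_primitive hvint 0
  have hIneg : ∀ s ≤ 0, I s = 0 := by
    intro s hs
    simp only [hI]
    rw [intervalIntegral.integral_zero_ae]
    refine Eventually.of_forall fun x hx => ?_
    rw [uIoc_of_ge hs] at hx
    exact hv0neg x hx.2
  have hIdiff : ∀ a b, I b - I a = ∫ s in a..b, v0 s := fun a b =>
    intervalIntegral.integral_interval_sub_left (hvint _ _) (hvint _ _)
  obtain ⟨K, hK⟩ := isCompact_Icc.exists_bound_of_continuousOn (s := Icc 0 T) hv.continuousOn
  have hK0 : 0 ≤ K := (norm_nonneg _).trans (hK 0 ⟨le_rfl, hT.le⟩)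
  have hIlip : ∀ x y, x ≤ y → y ≤ T → |I y - I x| ≤ K * (y - x) := by
    intro x y hxy hy
    rw [hIdiff, ← abs_of_nonneg (sub_nonneg.2 hxy)]
    refine intervalIntegral.norm_integral_le_of_norm_le_const (E := ℝ) fun s hs => ?_
    rw [uIoc_of_le hxy] at hs
    rcases le_or_gt s 0 with h | h
    · rw [hv0neg s h, norm_zero]; exact hK0
    · rw [hv0pos s h]; exact hK s ⟨h.le, hs.2.trans hy⟩
  set G := auxConv m v0 with hG
  have hGneg : ∀ x ≤ 0, G x = 0 := by
    intro x hx
    simp only [hG, auxConv]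
    rw [intervalIntegral.integral_zero_ae]
    refine Eventually.of_forall fun y hy => ?_
    rw [uIoc_of_ge hx] at hy
    rw [hv0neg y hy.2, mul_zero]
  have hGpos : ∀ x ≥ 0, G x = auxConv m v x := by
    intro x hx
    simp only [hG, auxConv]
    refine intervalIntegral.integral_congr_ae (Eventually.of_forall fun y hy => ?_)
    rw [uIoc_of_le hx] at hy
    rw [hv0pos y hy.1]
  have hGmono : MonotoneOn G (Iic T) := by
    intro x hx y hy hxy
    have hzero : auxConv m v 0 = 0 := by simp [auxConv]
    rcases le_or_gt x 0 with h | h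
    · rw [hGneg x h]
      rcases le_or_gt y 0 with h' | h'
      · rw [hGneg y h']
      · rw [hGpos y h'.le, ← hzero]
        exact hmono ⟨le_rfl, hT.le⟩ ⟨h'.le, hy⟩ h'.le
    · rw [hGpos x h.le, hGpos y (h.le.trans hxy)]
      exact hmono ⟨h.le, hx⟩ ⟨h.le.trans hxy, hy⟩ hxy
  have hGint : ∀ a b, a ≤ T → b ≤ T → IntervalIntegrable G volume a b := by
    intro a b ha hb
    refine MonotoneOn.intervalIntegrable (hGmono.mono ?_)
    intro x hx
    exact hx.2.trans (max_le ha hb)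
  have hconvI : ∀ x, auxConv m I x = ∫ s in (0:ℝ)..x, G s := by
    intro x
    rcases le_or_gt x 0 with h | h
    · have l1 : auxConv m I x = 0 := by
        simp only [auxConv]
        rw [intervalIntegral.integral_zero_ae]
        refine Eventually.of_forall fun y hy => ?_
        rw [uIoc_of_ge h] at hy
        rw [hIneg y hy.2, mul_zero]
      rw [l1, intervalIntegral.integral_zero_ae]
      refine Eventually.of_forall fun y hy => ?_
      rw [uIoc_of_ge h] at hy
      exact hGneg y hy.2
    · exact (auxConv_integral' m v0 x h.le (hint x)
        ((intervalIntegrable_iff_integrableOn_Ioc_of_le h.le).1 (hvint 0 x))).symm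
  have hshift : ∀ t ≥ 0, ∫ s in (0:ℝ)..t, m (t - s) * I (s - ε) = auxConv m I (t - ε) := by
    intro t ht
    have h1 := intervalIntegral.integral_comp_sub_right (fun s => m (t - ε - s) * I s) ε
      (a := 0) (b := t)
    simp only [show ∀ s, t - ε - (s - ε) = t - s from fun s => by ring] at h1
    rw [h1]
    have hz : ∀ b ≤ 0, ∀ a ≤ b, EqOn (fun s => m (t - ε - s) * I s) (fun _ => 0) (uIoc a b) := by
      intro b hb a hab s hs
      rw [uIoc_of_le hab] at hs
      simp only
      rw [hIneg s (hs.2.trans hb), mul_zero]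
    rcases le_or_gt (t - ε) 0 with h | h
    · rw [intervalIntegral.integral_congr_ae (Eventually.of_forall fun s hs =>
        hz (t - ε) h (0 - ε) (by linarith) hs), hconvI]
      rw [intervalIntegral.integral_zero_ae (f := G)]
      · simp
      refine Eventually.of_forall fun y hy => ?_
      rw [uIoc_of_ge h] at hy
      exact hGneg y hy.2
    · rw [← intervalIntegral.integral_add_adjacent_intervals (b := 0)]
      · rw [intervalIntegral.integral_congr_ae (Eventually.of_forall fun s hs =>
          hz 0 le_rfl (0 - ε) (by linarith) hs)]
        simp [auxConv]
      · have : IntervalIntegrable (fun _ : ℝ => (0:ℝ)) volume (0 - ε) 0 := intervalIntegrable_const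
        exact this.congr (hz 0 le_rfl (0 - ε) (by linarith)).symm
      · exact (aux_ii m hint 0 (t - ε) (t - ε) le_rfl h.le le_rfl).mul_continuousOn hIc.continuousOn
  have hconvw : ∀ t ∈ Icc 0 T, auxConv m (fun s => I s - I (s - ε)) t
      = ∫ r in (0:ℝ)..ε, G (t - r) := by
    intro t ht
    have i1 := aux_ii m hint 0 t t le_rfl ht.1 le_rfl
    have hc2 : Continuous fun s => I (s - ε) := by fun_prop
    have : auxConv m (fun s => I s - I (s - ε)) t
        = auxConv m I t - ∫ s in (0:ℝ)..t, m (t - s) * I (s - ε) := by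
      unfold auxConv
      rw [← intervalIntegral.integral_sub (i1.mul_continuousOn hIc.continuousOn)
        (i1.mul_continuousOn hc2.continuousOn)]
      congr 1; ext s; ring
    rw [this, hshift t ht.1, hconvI, hconvI, intervalIntegral.integral_comp_sub_left (fun x => G x),
      intervalIntegral.integral_interval_sub_left (hGint _ _ hT.le ht.2)
        (hGint _ _ hT.le (by linarith [ht.2])), sub_zero]
  have hfinal := aux_mp_lip m (fun s => I s - I (s - ε)) T (2 * K) hpos hanti hint
    (by fun_prop) (by
      intro x y hx hxy hy
      have h1 := abs_le.1 (hIlip x y hxy hy)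
      have h2 := abs_le.1 (hIlip (x - ε) (y - ε) (by linarith) (by linarith))
      nlinarith [h1.1, h1.2, h2.1, h2.2]) (by positivity)
    (by simp [hIneg 0 le_rfl, hIneg (-ε) (by linarith)]) (by
      intro x hx y hy hxy
      rw [hconvw x hx, hconvw y hy]
      have hcx : ∀ z ≤ T, IntervalIntegrable (fun r => G (z - r)) volume 0 ε := by
        intro z hz
        have := (hGint z (z - ε) hz (by linarith)).comp_sub_left z
        simpa using this
      refine intervalIntegral.integral_mono_on hε0.le (hcx x hx.2) (hcx y hy.2) ?_
      intro r hr
      exact hGmono (show x - r ≤ T by linarith [hx.2, hr.1])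
        (show y - r ≤ T by linarith [hy.2, hr.1]) (by linarith))
    t0 ⟨ht0.1.le, ht0.2⟩
  rw [hIdiff] at hfinal
  have hlt : 0 < ∫ s in (t0 - ε)..t0, -v0 s := by
    refine intervalIntegral.intervalIntegral_pos_of_pos_on (hvint _ _).neg ?_ (by linarith)
    intro s hs
    rw [hv0pos s (by linarith [hs.1])]
    linarith [hε s ⟨hs.1.le, hs.2.le⟩]
  rw [intervalIntegral.integral_neg] at hlt
  linarith

lemma aux_sigmaFinite (σ : Measure ℝ) (hsupp : σ (Iio 0) = 0)
    (hσint : Integrable (fun t : ℝ => (1 + t)⁻¹) σ) : SigmaFinite σ := by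
  have : IsLocallyFiniteMeasure σ := by
    refine ⟨fun x => ⟨Iio (|x| + 1), Iio_mem_nhds (by linarith [le_abs_self x]), ?_⟩⟩
    have h1 := hσint.measure_norm_ge_lt_top (ε := (|x| + 2)⁻¹) (by positivity)
    refine (measure_mono (t := Iio 0 ∪ {t : ℝ | (|x| + 2)⁻¹ ≤ ‖(1 + t)⁻¹‖}) ?_).trans_lt
      ((measure_union_le _ _).trans_lt (by rw [hsupp, zero_add]; exact h1))
    intro t ht
    rcases lt_or_ge t 0 with h | h
    · left; exact h
    · right
      show (|x| + 2)⁻¹ ≤ ‖(1 + t)⁻¹‖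
      rw [Real.norm_of_nonneg (by positivity)]
      have : t < |x| + 1 := ht
      exact inv_anti₀ (by positivity) (by linarith)
  infer_instance

lemma aux_ae_nonneg (σ : Measure ℝ) (hsupp : σ (Iio 0) = 0) : ∀ᵐ t ∂σ, 0 ≤ t := by
  rw [ae_iff]; convert hsupp using 2; ext t; simp

lemma aux_inv_int (σ : Measure ℝ) (h0 : ∀ᵐ t ∂σ, 0 ≤ t)
    (hσint : Integrable (fun t : ℝ => (1 + t)⁻¹) σ) (p : ℝ) (hp : 0 < p) :
    Integrable (fun t : ℝ => (p + t)⁻¹) σ := by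
  refine (hσint.const_mul (max 1 p⁻¹)).mono' (by fun_prop) ?_
  filter_upwards [h0] with t ht
  rw [Real.norm_of_nonneg (by positivity)]
  rw [← div_eq_mul_inv, inv_eq_one_div, div_le_div_iff₀ (by positivity) (by positivity)]
  have h1 : 1 ≤ max 1 p⁻¹ := le_max_left _ _
  have h2 : 1 ≤ max 1 p⁻¹ * p := by
    calc 1 = p⁻¹ * p := by field_simp
      _ ≤ _ := by gcongr; exact le_max_right _ _
  nlinarith

lemma aux_exp_int (σ : Measure ℝ) (h0 : ∀ᵐ t ∂σ, 0 ≤ t)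
    (hσint : Integrable (fun t : ℝ => (1 + t)⁻¹) σ) (x : ℝ) (hx : 0 < x) :
    Integrable (fun t : ℝ => Real.exp (-x * t)) σ := by
  refine ((aux_inv_int σ h0 hσint x⁻¹ (by positivity)).const_mul x⁻¹).mono' (by fun_prop) ?_
  filter_upwards [h0] with t ht
  rw [Real.norm_of_nonneg (by positivity)]
  have h1 := Real.add_one_le_exp (x * t)
  rw [show -x * t = -(x * t) by ring, Real.exp_neg]
  have h2 : x⁻¹ * (x⁻¹ + t)⁻¹ = (x * t + 1)⁻¹ := by
    rw [← mul_inv]; congr 1; field_simp; ring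
  rw [h2]
  exact inv_anti₀ (by positivity) h1

lemma aux_prod_int (σ : Measure ℝ) [SigmaFinite σ] (h0 : ∀ᵐ t ∂σ, 0 ≤ t)
    (hσint : Integrable (fun t : ℝ => (1 + t)⁻¹) σ) (g : ℝ → ℝ) (hg : Measurable g)
    (hg0 : ∀ t ≥ 0, 0 ≤ g t) (hg1 : ∀ t ≥ 0, g t ≤ 1) (p : ℝ) (hp : 0 < p) :
    Integrable (Function.uncurry fun x t => Real.exp (-p * x) * (Real.exp (-x * t) * g t))
      ((volume.restrict (Ioi 0)).prod σ) := by
  have hmeas : Measurable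
      (Function.uncurry fun x t : ℝ => Real.exp (-p * x) * (Real.exp (-x * t) * g t)) := by
    unfold Function.uncurry; fun_prop
  have e : ∀ t, (fun x => Real.exp (-p * x) * (Real.exp (-x * t) * g t))
      = fun x => Real.exp (-(p + t) * x) * g t := by
    intro t; ext x
    rw [← mul_assoc, ← Real.exp_add]; congr 2; ring
  rw [integrable_prod_iff' hmeas.aestronglyMeasurable]
  constructor
  · filter_upwards [h0] with t ht
    show Integrable (fun x => Real.exp (-p * x) * (Real.exp (-x * t) * g t)) _
    rw [e]
    exact (integrableOn_exp_mul_Ioi (by linarith) 0).mul_const _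
  · refine (aux_inv_int σ h0 hσint p hp).mono' ?_ ?_
    · exact hmeas.aestronglyMeasurable.norm.prod_swap.integral_prod_right'
    · filter_upwards [h0] with t ht
      have : ∫ x in Ioi (0:ℝ), ‖Real.exp (-p * x) * (Real.exp (-x * t) * g t)‖
          = g t * (p + t)⁻¹ := by
        have : ∀ x : ℝ, ‖Real.exp (-p * x) * (Real.exp (-x * t) * g t)‖
            = Real.exp (-(p + t) * x) * g t := by
          intro x
          rw [Real.norm_of_nonneg (by have := hg0 t ht; positivity)]
          exact congrFun (e t) x
        simp_rw [this]
        rw [integral_mul_const, integral_exp_mul_Ioi (by linarith)]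
        rw [mul_zero, Real.exp_zero, neg_div_neg_eq]; ring
      have h2 : 0 ≤ (p + t)⁻¹ := by positivity
      simp only [Function.uncurry]
      rw [this, Real.norm_of_nonneg (mul_nonneg (hg0 t ht) h2)]
      exact mul_le_of_le_one_left h2 (hg1 t ht)

lemma aux_stieltjes (σ : Measure ℝ) [SigmaFinite σ] (h0 : ∀ᵐ t ∂σ, 0 ≤ t)
    (hσint : Integrable (fun t : ℝ => (1 + t)⁻¹) σ) (g : ℝ → ℝ) (hg : Measurable g)
    (hg0 : ∀ t ≥ 0, 0 ≤ g t) (hg1 : ∀ t ≥ 0, g t ≤ 1) (p : ℝ) (hp : 0 < p) :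
    IntegrableOn (fun x => Real.exp (-p * x) * ∫ t, Real.exp (-x * t) * g t ∂σ) (Ioi 0) ∧
    ∫ x in Ioi (0:ℝ), Real.exp (-p * x) * ∫ t, Real.exp (-x * t) * g t ∂σ
      = ∫ t, g t * (p + t)⁻¹ ∂σ := by
  have hI := aux_prod_int σ h0 hσint g hg hg0 hg1 p hp
  constructor
  · have := hI.integral_prod_left
    simp only [Function.uncurry, integral_const_mul] at this
    exact this
  · have := integral_integral_swap hI
    simp only [integral_const_mul] at this
    rw [this]
    refine integral_congr_ae ?_
    filter_upwards [h0] with t ht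
    have : ∀ x : ℝ, Real.exp (-p * x) * (Real.exp (-x * t) * g t)
            = Real.exp (-(p + t) * x) * g t := by
      intro x
      rw [← mul_assoc, ← Real.exp_add]; congr 2; ring
    simp_rw [this]
    rw [integral_mul_const, integral_exp_mul_Ioi (by linarith)]
    rw [mul_zero, Real.exp_zero, neg_div_neg_eq]; ring

lemma aux_loc (f : ℝ → ℝ)
    (hf : IntegrableOn (fun x => Real.exp (-1 * x) * f x) (Ioi 0)) (t : ℝ) :
    IntegrableOn f (Ioc 0 t) := by
  have h1 : IntegrableOn (fun x => Real.exp (-1 * x) * f x) (Ioc 0 t) :=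
    hf.mono_set Ioc_subset_Ioi_self
  rw [← integrableOn_Icc_iff_integrableOn_Ioc] at h1 ⊢
  have := IntegrableOn.continuousOn_mul (g := fun x => Real.exp x) (by fun_prop) h1 isCompact_Icc
  refine this.congr_fun (fun x _ => ?_) measurableSet_Icc
  simp only
  rw [← mul_assoc, ← Real.exp_add]; simp

lemma aux_relation (σ : Measure ℝ) [SigmaFinite σ] (h0 : ∀ᵐ t ∂σ, 0 ≤ t)
    (hσint : Integrable (fun t : ℝ => (1 + t)⁻¹) σ) (p : ℝ) (hp : 0 < p) (x : ℝ) (hx : 0 < x) :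
    ∫ t, Real.exp (-x * t) ∂σ = (∫ t, Real.exp (-x * t) * (t / (p + t)) ∂σ)
      + p * (∫ t, (p + t)⁻¹ ∂σ)
      - p * ∫ y in (0:ℝ)..x, ∫ t, Real.exp (-y * t) * (t / (p + t)) ∂σ := by
  have hI := aux_prod_int σ h0 hσint (fun t => t / (p + t)) (by fun_prop)
    (fun t ht => by positivity) (fun t ht => by
      have ht' : 0 ≤ t := ht
      rw [div_le_one (by positivity)]; linarith) 1 one_pos
  have hI2 : Integrable (Function.uncurry fun y t => Real.exp (-y * t) * (t / (p + t)))
      ((volume.restrict (uIoc 0 x)).prod σ) := by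
    have hI' : Integrable (Function.uncurry fun x t =>
        Real.exp (-1 * x) * (Real.exp (-x * t) * (t / (p + t))))
        ((volume.restrict (uIoc 0 x)).prod σ) := by
      refine hI.mono_measure ?_
      refine Measure.prod_mono (Measure.restrict_mono ?_ le_rfl) le_rfl
      rw [uIoc_of_le hx.le]; exact Ioc_subset_Ioi_self
    refine (hI'.norm.const_mul (Real.exp x)).mono' ?_ ?_
    · refine Measurable.aestronglyMeasurable ?_
      unfold Function.uncurry; fun_prop
    · have : ∀ᵐ z ∂((volume.restrict (uIoc 0 x)).prod σ), z.1 ∈ uIoc 0 x :=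
        Measure.quasiMeasurePreserving_fst.ae (ae_restrict_mem measurableSet_uIoc)
      filter_upwards [this] with z hz
      rw [uIoc_of_le hx.le] at hz
      simp only [Function.uncurry]
      rw [norm_mul (Real.exp (-1 * z.1)), ← mul_assoc]
      refine le_mul_of_one_le_left (norm_nonneg _) ?_
      rw [Real.norm_of_nonneg (Real.exp_pos _).le, ← Real.exp_add]
      exact Real.one_le_exp (by linarith [hz.2])
  rw [intervalIntegral_integral_swap hI2, ← integral_const_mul, ← integral_const_mul]
  have hi := aux_inv_int σ h0 hσint p hp
  have he := aux_exp_int σ h0 hσint x hx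
  have inner : ∀ᵐ t ∂σ, p * ∫ y in (0:ℝ)..x, Real.exp (-y * t) * (t / (p + t))
      = p * (p + t)⁻¹ - (Real.exp (-x * t) - Real.exp (-x * t) * (t / (p + t))) := by
    filter_upwards [h0] with t ht
    have hd : ∫ y in (0:ℝ)..x, Real.exp (-y * t) * (t / (p + t))
        = -Real.exp (-x * t) * (p + t)⁻¹ - (-Real.exp (-0 * t) * (p + t)⁻¹) := by
      refine intervalIntegral.integral_eq_sub_of_hasDerivAt
        (f := fun y => -Real.exp (-y * t) * (p + t)⁻¹) (fun y _ => ?_)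
        (Continuous.intervalIntegrable (by fun_prop) _ _)
      have h1 : HasDerivAt (fun y : ℝ => -y * t) (-1 * t) y := (hasDerivAt_id y).neg.mul_const t
      have h2 : HasDerivAt (fun y : ℝ => -Real.exp (-y * t) * (p + t)⁻¹) _ y :=
        h1.exp.neg.mul_const (p + t)⁻¹
      exact h2.congr_deriv (by ring)
    rw [hd]
    have : p + t ≠ 0 := by positivity
    simp
    field_simp
    ring
  rw [integral_congr_ae inner]
  have hm : Integrable (fun t => Real.exp (-x * t) * (t / (p + t))) σ := by
    refine he.mono' (by fun_prop) ?_
    filter_upwards [h0] with t ht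
    rw [Real.norm_of_nonneg (by positivity)]
    refine mul_le_of_le_one_right (by positivity) ?_
    rw [div_le_one (by positivity)]; linarith
  have := integral_sub (hi.const_mul p) (he.sub hm)
  simp only [Pi.sub_apply] at this
  rw [this, integral_sub he hm]
  ring

lemma aux_antitone (σ : Measure ℝ) (h0 : ∀ᵐ t ∂σ, 0 ≤ t)
    (hσint : Integrable (fun t : ℝ => (1 + t)⁻¹) σ) (g : ℝ → ℝ) (hg : Measurable g)
    (hg0 : ∀ t ≥ 0, 0 ≤ g t) (hg1 : ∀ t ≥ 0, g t ≤ 1) :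
    AntitoneOn (fun x => ∫ t, Real.exp (-x * t) * g t ∂σ) (Ioi 0) := by
  have hm : ∀ x > 0, Integrable (fun t => Real.exp (-x * t) * g t) σ := by
    intro x hx
    refine (aux_exp_int σ h0 hσint x hx).mono' (by fun_prop) ?_
    filter_upwards [h0] with t ht
    rw [Real.norm_of_nonneg (mul_nonneg (by positivity) (hg0 t ht))]
    exact mul_le_of_le_one_right (by positivity) (hg1 t ht)
  intro x hx y hy hxy
  refine integral_mono_ae (hm y hy) (hm x hx) ?_
  filter_upwards [h0] with t ht
  refine mul_le_mul_of_nonneg_right (Real.exp_le_exp.2 ?_) (hg0 t ht)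
  nlinarith

lemma aux_hasDeriv (σ : Measure ℝ) (h0 : ∀ᵐ t ∂σ, 0 ≤ t)
    (hσint : Integrable (fun t : ℝ => (1 + t)⁻¹) σ) (Φ : ℝ → ℝ)
    (hΦ : ∀ p > 0, Φ p = p * ∫ t : ℝ, (p + t)⁻¹ ∂σ) (p₀ : ℝ) (hp₀ : 0 < p₀) :
    HasDerivAt Φ (∫ t, t / (p₀ + t) * (p₀ + t)⁻¹ ∂σ) p₀ := by
  rw [hasDerivAt_iff_tendsto_slope]
  have hev : ∀ᶠ p in nhdsWithin p₀ {p₀}ᶜ, p₀ / 2 < p := by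
    exact nhdsWithin_le_nhds (eventually_gt_nhds (by linarith))
  have hne : ∀ᶠ p in nhdsWithin p₀ {p₀}ᶜ, p ≠ p₀ := eventually_mem_nhdsWithin
  have hlim : Tendsto (fun p => ∫ t, t / (p₀ + t) * (p + t)⁻¹ ∂σ) (nhdsWithin p₀ {p₀}ᶜ)
      (nhds (∫ t, t / (p₀ + t) * (p₀ + t)⁻¹ ∂σ)) := by
    refine tendsto_integral_filter_of_dominated_convergence (fun t => (p₀ / 2 + t)⁻¹) ?_ ?_
      (aux_inv_int σ h0 hσint _ (by positivity)) ?_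
    · exact Eventually.of_forall fun p => by fun_prop
    · filter_upwards [hev] with p hp
      filter_upwards [h0] with t ht
      have : 0 < p := by linarith
      rw [Real.norm_of_nonneg (by positivity)]
      calc t / (p₀ + t) * (p + t)⁻¹ ≤ 1 * (p₀ / 2 + t)⁻¹ := by
            gcongr
            rw [div_le_one (by positivity)]; linarith
        _ = _ := one_mul _
    · filter_upwards [h0] with t ht
      have : ContinuousAt (fun p => t / (p₀ + t) * (p + t)⁻¹) p₀ := by
        refine ContinuousAt.mul continuousAt_const (ContinuousAt.inv₀ (by fun_prop) (by positivity))
      exact this.tendsto.mono_left nhdsWithin_le_nhds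
  refine hlim.congr' ?_
  filter_upwards [hev, hne] with p hp hpne
  have hp0 : 0 < p := by linarith
  rw [slope_def_field, hΦ p hp0, hΦ p₀ hp₀, ← integral_const_mul, ← integral_const_mul,
    ← integral_sub ((aux_inv_int σ h0 hσint p hp0).const_mul _)
      ((aux_inv_int σ h0 hσint p₀ hp₀).const_mul _), ← integral_div]
  refine integral_congr_ae ?_
  filter_upwards [h0] with t ht
  have h1 : p + t ≠ 0 := by positivity
  have h2 : p₀ + t ≠ 0 := by positivity
  have h3 : p - p₀ ≠ 0 := sub_ne_zero.2 hpne
  field_simp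
  ring

lemma aux_pos (σ : Measure ℝ) (h0 : ∀ᵐ t ∂σ, 0 ≤ t)
    (hσint : Integrable (fun t : ℝ => (1 + t)⁻¹) σ) (Φ : ℝ → ℝ)
    (hΦ : ∀ p > 0, Φ p = p * ∫ t : ℝ, (p + t)⁻¹ ∂σ) (hΦinf : Tendsto Φ atTop atTop)
    (p₀ : ℝ) (hp₀ : 0 < p₀) (x : ℝ) (hx : 0 < x) :
    0 < ∫ t, Real.exp (-x * t) * (t / (p₀ + t)) ∂σ := by
  have hnn : ∀ᵐ t ∂σ, 0 ≤ Real.exp (-x * t) * (t / (p₀ + t)) := by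
    filter_upwards [h0] with t ht
    positivity
  have hm : Integrable (fun t => Real.exp (-x * t) * (t / (p₀ + t))) σ := by
    refine (aux_exp_int σ h0 hσint x hx).mono' (by fun_prop) ?_
    filter_upwards [h0] with t ht
    rw [Real.norm_of_nonneg (by positivity)]
    refine mul_le_of_le_one_right (by positivity) ?_
    rw [div_le_one (by positivity)]; linarith
  refine lt_of_le_of_ne (integral_nonneg_of_ae hnn) fun h => ?_
  rw [eq_comm, integral_eq_zero_iff_of_nonneg_ae hnn hm] at h
  have hz : ∀ᵐ t ∂σ, t = 0 := by
    filter_upwards [h, h0] with t ht ht0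
    have h2 : p₀ + t ≠ 0 := by positivity
    simpa [(Real.exp_pos _).ne', h2] using ht
  have hc : ∀ p > 0, Φ p = ∫ t : ℝ, (1 : ℝ) ∂σ := by
    intro p hp
    rw [hΦ p hp, ← integral_const_mul]
    refine integral_congr_ae ?_
    filter_upwards [hz] with t ht
    rw [ht]; field_simp; simp
  obtain ⟨p, hp, hp'⟩ := ((hΦinf.eventually_gt_atTop (∫ t : ℝ, (1 : ℝ) ∂σ)).and
    (eventually_gt_atTop 0)).exists
  rw [hc p hp'] at hp
  exact lt_irrefl _ hp

lemma aux_conv_congr (k kt U : ℝ → ℝ) (hkk : k =ᵐ[volume.restrict (Ioi 0)] kt) (t : ℝ)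
    (ht : 0 ≤ t) : auxConv k U t = auxConv kt U t := by
  rw [auxConv_comm k, auxConv_comm kt]
  unfold auxConv
  refine intervalIntegral.integral_congr_ae ?_
  rw [Filter.EventuallyEq, ae_restrict_iff' measurableSet_Ioi] at hkk
  filter_upwards [hkk] with s hs hst
  rw [uIoc_of_le ht] at hst
  rw [hs hst.1]

/-- Integrated form of the equation as long as the solution stays positive. -/
lemma aux_integrated (k U u : ℝ → ℝ) (hknn : ∀ t > 0, 0 ≤ k t)
    (hkint : ∀ t, IntegrableOn k (Ioc 0 t)) (hU : Continuous U) (hUu : ∀ t ≥ 0, U t = u t)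
    (lam : ℝ) (hlam : 0 < lam) (hu0 : u 0 = 1)
    (hode : ∀ t > 0, genFracDeriv k u t = lam * u t) (t : ℝ) (ht : 0 ≤ t)
    (hpos : ∀ s ∈ Icc 0 t, 0 < U s) :
    auxConv k U t = (∫ s in (0:ℝ)..t, k s) + lam * ∫ s in (0:ℝ)..t, U s := by
  have hder : ∀ s ∈ Ioc 0 t, HasDerivAt (auxConv k U) (k s + lam * U s) s := by
    intro s hs
    have hEq : (fun r => ∫ τ in (0:ℝ)..r, k (r - τ) * u τ) =ᶠ[nhds s] auxConv k U := by
      filter_upwards [eventually_gt_nhds hs.1] with r hr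
      unfold auxConv
      refine intervalIntegral.integral_congr fun τ hτ => ?_
      rw [uIcc_of_le hr.le] at hτ
      rw [hUu τ hτ.1]
    have h1 := hode s hs.1
    unfold genFracDeriv at h1
    rw [hEq.deriv_eq, hu0, mul_one] at h1
    have hUs := hpos s ⟨hs.1.le, hs.2⟩
    rw [hUu s hs.1.le] at hUs ⊢
    have hd : DifferentiableAt ℝ (auxConv k U) s := by
      by_contra hnd
      rw [deriv_zero_of_not_differentiableAt hnd] at h1
      have := hknn s hs.1
      nlinarith [mul_pos hlam hUs]
    have h2 := hd.hasDerivAt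
    rwa [show deriv (auxConv k U) s = k s + lam * u s by linarith] at h2
  have h00 : auxConv k U 0 = 0 := by simp [auxConv]
  have hcont : ContinuousOn (auxConv k U) (Icc 0 t) := by
    intro s hs
    rcases eq_or_lt_of_le hs.1 with h | h
    · rw [← h]
      have hw : ContinuousWithinAt (auxConv k U) (Ioi 0) 0 := by
        obtain ⟨K, hK⟩ := isCompact_Icc.exists_bound_of_continuousOn (s := Icc 0 1) hU.continuousOn
        rw [ContinuousWithinAt, h00]
        refine squeeze_zero_norm' (a := fun r => K * ∫ x in (0:ℝ)..r, k x) ?_ ?_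
        · filter_upwards [Ioc_mem_nhdsGT one_pos] with r hr
          rw [auxConv_comm, auxConv, ← intervalIntegral.integral_const_mul]
          refine intervalIntegral.norm_integral_le_of_norm_le hr.1.le
            (Eventually.of_forall fun x hx => ?_)
            ((aux_mii k hkint 0 r le_rfl hr.1.le).const_mul K)
          rw [norm_mul, Real.norm_of_nonneg (hknn x hx.1)]
          exact mul_le_mul_of_nonneg_right
            (hK _ ⟨by linarith [hx.2], by linarith [hx.1, hr.2]⟩) (hknn x hx.1)
        · simpa using (aux_prim_tendsto k hkint).const_mul K
      exact (continuousWithinAt_Ioi_iff_Ici.1 hw).mono Icc_subset_Ici_self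
    · exact (hder s ⟨h, hs.2⟩).continuousAt.continuousWithinAt
  have i1 := aux_mii k hkint 0 t le_rfl ht
  have i2 : IntervalIntegrable (fun s => lam * U s) volume 0 t :=
    (hU.const_mul lam).intervalIntegrable _ _
  have := intervalIntegral.integral_eq_sub_of_hasDerivAt_of_le ht hcont
    (fun x hx => hder x ⟨hx.1, hx.2.le⟩) (i1.add i2)
  rw [h00, sub_zero, intervalIntegral.integral_add i1 i2,
    intervalIntegral.integral_const_mul] at this
  exact this.symm

lemma aux_prim_mono (f : ℝ → ℝ) (T : ℝ) (hi : ∀ t, 0 ≤ t → t ≤ T → IntervalIntegrable f volume 0 t)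
    (hf : ∀ x, 0 < x → x ≤ T → 0 ≤ f x) :
    MonotoneOn (fun t => ∫ s in (0:ℝ)..t, f s) (Icc 0 T) := by
  intro x hx y hy hxy
  have h1 := intervalIntegral.integral_interval_sub_left (hi y hy.1 hy.2) (hi x hx.1 hx.2)
  have h2 : 0 ≤ ∫ s in x..y, f s := by
    rw [intervalIntegral.integral_of_le hxy]
    refine setIntegral_nonneg measurableSet_Ioc fun s hs => hf s ?_ ?_
    · linarith [hx.1, hs.1]
    · linarith [hy.2, hs.2]
  simp only
  linarith

/-- Positivity of the solution. -/
lemma aux_solution_pos (k kt U u : ℝ → ℝ) (hknn : ∀ t > 0, 0 ≤ k t)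
    (hkint : ∀ t, IntegrableOn k (Ioc 0 t)) (hkk : k =ᵐ[volume.restrict (Ioi 0)] kt)
    (hktint : ∀ t, IntegrableOn kt (Ioc 0 t)) (hktpos : ∀ t > 0, 0 < kt t)
    (hktanti : AntitoneOn kt (Ioi 0))
    (hU : Continuous U) (hUu : ∀ t ≥ 0, U t = u t)
    (lam : ℝ) (hlam : 0 < lam) (hu0 : u 0 = 1)
    (hode : ∀ t > 0, genFracDeriv k u t = lam * u t) : ∀ t ≥ 0, 0 < U t := by
  by_contra hcon
  push Not at hcon
  obtain ⟨t1, ht1, hneg⟩ := hcon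
  set S : Set ℝ := {t | 0 ≤ t ∧ U t ≤ 0} with hS
  have hSc : IsClosed S := by
    exact (isClosed_le continuous_const continuous_id).inter (isClosed_le hU continuous_const)
  have hSb : BddBelow S := ⟨0, fun t ht => ht.1⟩
  have hTS : sInf S ∈ S := hSc.csInf_mem ⟨t1, ht1, hneg⟩ hSb
  set T := sInf S with hT
  have hU0 : U 0 = 1 := by rw [hUu 0 le_rfl, hu0]
  have hT0 : 0 < T := lt_of_le_of_ne hTS.1 (by
    intro h; have := hTS.2; rw [← h, hU0] at this; linarith)
  have hbefore : ∀ s, 0 ≤ s → s < T → 0 < U s := by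
    intro s hs hsT
    by_contra hle
    exact absurd (csInf_le hSb ⟨hs, not_lt.1 hle⟩) (not_le.2 hsT)
  have hge : ∀ s ∈ Ioo 0 T, 1 ≤ U s := by
    intro s hs
    have hmono : MonotoneOn (auxConv kt (fun x => U x - 1)) (Icc 0 s) := by
      have := aux_prim_mono (fun x => lam * U x) s
        (fun t _ _ => (hU.const_mul lam).intervalIntegrable _ _)
        (fun x hx hxs => (mul_pos hlam (hbefore x hx.le (by linarith [hs.2]))).le)
      refine this.congr fun t ht => ?_
      have h1 := aux_integrated k U u hknn hkint hU hUu lam hlam hu0 hode t ht.1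
        (fun r hr => hbefore r hr.1 (by linarith [hr.2, ht.2, hs.2]))
      have e1 : auxConv k (fun x => U x - 1) t = auxConv k U t - ∫ s in (0:ℝ)..t, k s := by
        have i1 := aux_ii k hkint 0 t t le_rfl ht.1 le_rfl
        have e2 : ∫ s in (0:ℝ)..t, k s = ∫ s in (0:ℝ)..t, k (t - s) := by
          rw [intervalIntegral.integral_comp_sub_left (fun x => k x) t]; simp
        unfold auxConv
        rw [e2, ← intervalIntegral.integral_sub (i1.mul_continuousOn hU.continuousOn) i1]
        congr 1; ext x; ring
      simp only
      rw [← aux_conv_congr k kt _ hkk t ht.1, e1, h1, intervalIntegral.integral_const_mul]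
      ring
    have := aux_mp kt (fun x => U x - 1) s hktpos hktanti hktint (hU.sub continuous_const) hmono
      s ⟨hs.1, le_rfl⟩
    linarith
  have hlim : Tendsto U (nhdsWithin T (Iio T)) (nhds (U T)) :=
    hU.continuousAt.tendsto.mono_left nhdsWithin_le_nhds
  have := ge_of_tendsto hlim (b := 1) (by
    filter_upwards [Ioo_mem_nhdsLT hT0] with s hs
    exact hge s hs)
  linarith [hTS.2]

lemma aux_prim_integrable (m : ℝ → ℝ) (hm : ∀ t, IntegrableOn m (Ioc 0 t)) (t : ℝ) :
    IntegrableOn (fun x => ∫ r in (0:ℝ)..x, m r) (Ioc 0 t) := by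
  rcases le_or_gt 0 t with ht | ht
  · have h1 : IntegrableOn m (uIcc 0 t) := by
      rw [uIcc_of_le ht, integrableOn_Icc_iff_integrableOn_Ioc]; exact hm t
    have h2 := intervalIntegral.continuousOn_primitive_interval h1
    rw [uIcc_of_le ht] at h2
    exact (h2.integrableOn_Icc).mono_set Ioc_subset_Icc_self
  · rw [Ioc_eq_empty (by linarith)]; exact integrableOn_empty

lemma aux_conv_ii (m : ℝ → ℝ) (hm : ∀ t, IntegrableOn m (Ioc 0 t)) (v : ℝ → ℝ) (hv : Continuous v)
    (t : ℝ) (ht : 0 ≤ t) : IntervalIntegrable (fun s => m (t - s) * v s) volume 0 t :=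
  (aux_ii m hm 0 t t le_rfl ht le_rfl).mul_continuousOn hv.continuousOn

/-- The reduced equation for `Y = U - p₀ ∫ U`. -/
lemma aux_Y (m kt U : ℝ → ℝ) (lam p₀ : ℝ) (hm : ∀ t, IntegrableOn m (Ioc 0 t))
    (hrel : ∀ x > 0, kt x = m x + lam - p₀ * ∫ y in (0:ℝ)..x, m y)
    (hU : Continuous U) (t : ℝ) (ht : 0 ≤ t)
    (hconv : auxConv kt U t = (∫ s in (0:ℝ)..t, kt s) + lam * ∫ s in (0:ℝ)..t, U s) :
    auxConv m (fun s => U s - p₀ * ∫ r in (0:ℝ)..s, U r) t = ∫ s in (0:ℝ)..t, kt s := by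
  set M : ℝ → ℝ := fun x => ∫ r in (0:ℝ)..x, m r with hM
  set I : ℝ → ℝ := fun x => ∫ r in (0:ℝ)..x, U r with hI
  have hIc : Continuous I := intervalIntegral.continuous_primitive
    (fun a b => hU.intervalIntegrable a b) 0
  have hUi : IntegrableOn U (Ioc 0 t) := (hU.integrableOn_Icc).mono_set Ioc_subset_Icc_self
  have e1 : auxConv m I t = auxConv M U t := by
    rw [hI, hM, ← auxConv_integral m U t ht (hm t) hUi, ← auxConv_integral' m U t ht (hm t) hUi]
  have i1 := aux_conv_ii m hm U hU t ht
  have i2 := (aux_conv_ii m hm I hIc t ht).const_mul p₀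
  have i3 := (aux_conv_ii M (aux_prim_integrable m hm) U hU t ht).const_mul p₀
  have i4 : IntervalIntegrable (fun s => lam * U s) volume 0 t :=
    (hU.const_mul lam).intervalIntegrable _ _
  have e2 : auxConv m (fun s => U s - p₀ * I s) t = auxConv m U t - p₀ * auxConv m I t := by
    unfold auxConv
    rw [← intervalIntegral.integral_const_mul, ← intervalIntegral.integral_sub i1 i2]
    congr 1; ext s; ring
  have e3 : auxConv kt U t = auxConv m U t + lam * I t - p₀ * auxConv M U t := by
    have : auxConv kt U t = ∫ s in (0:ℝ)..t,
        (m (t - s) * U s + lam * U s - p₀ * (M (t - s) * U s)) := by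
      unfold auxConv
      refine intervalIntegral.integral_congr_ae ?_
      have hne : ∀ᵐ s : ℝ, s ≠ t := by simp [ae_iff]
      filter_upwards [hne] with s hs hst
      rw [uIoc_of_le ht] at hst
      have hlt : s < t := lt_of_le_of_ne hst.2 hs
      rw [hrel (t - s) (by linarith)]
      simp only [hM]
      ring
    rw [this, intervalIntegral.integral_sub (i1.add i4) i3, intervalIntegral.integral_add i1 i4,
      intervalIntegral.integral_const_mul, intervalIntegral.integral_const_mul]
    rfl
  rw [e2, e1]
  have : lam * I t = lam * ∫ s in (0:ℝ)..t, U s := rfl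
  linarith

lemma aux_conv_const (m : ℝ → ℝ) (c t : ℝ) : auxConv m (fun _ => c) t = c * ∫ s in (0:ℝ)..t, m s := by
  rw [auxConv_comm]
  unfold auxConv
  rw [intervalIntegral.integral_const_mul]

lemma aux_conv_id (m : ℝ → ℝ) (hm : ∀ t, IntegrableOn m (Ioc 0 t)) (t : ℝ) (ht : 0 ≤ t) :
    auxConv m (fun s => s) t = ∫ x in (0:ℝ)..t, ∫ s in (0:ℝ)..x, m s := by
  have hc : IntegrableOn (fun _ : ℝ => (1:ℝ)) (Ioc 0 t) :=
    (continuous_const.integrableOn_Icc).mono_set Ioc_subset_Icc_self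
  have h := auxConv_integral' m (fun _ => (1:ℝ)) t ht (hm t) hc
  have e : (fun x : ℝ => ∫ r in (0:ℝ)..x, (1:ℝ)) = fun s => s := by ext x; simp
  rw [e] at h
  rw [← h]
  congr 1; ext x
  rw [aux_conv_const, one_mul]

lemma aux_Y_bounds (m kt Y : ℝ → ℝ) (lam p₀ : ℝ) (hlam : 0 < lam) (hp₀ : 0 < p₀)
    (hm : ∀ t, IntegrableOn m (Ioc 0 t)) (hkt : ∀ t, IntegrableOn kt (Ioc 0 t))
    (hmpos : ∀ t > 0, 0 < m t) (hktpos : ∀ t > 0, 0 < kt t) (hanti : AntitoneOn m (Ioi 0))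
    (hrel : ∀ x > 0, kt x = m x + lam - p₀ * ∫ y in (0:ℝ)..x, m y)
    (hY : Continuous Y) (hconv : ∀ t ≥ 0, auxConv m Y t = ∫ s in (0:ℝ)..t, kt s) :
    (∀ t > 0, 0 ≤ Y t) ∧ ∃ C ≥ 0, ∀ t > 0, Y t ≤ 1 + C + C * t := by
  constructor
  · intro t ht
    refine aux_mp m Y t hmpos hanti hm hY ?_ t ⟨ht, le_rfl⟩
    exact (aux_prim_mono kt t (fun s hs _ => aux_mii kt hkt 0 s le_rfl hs)
      (fun x hx _ => (hktpos x hx).le)).congr fun s hs => (hconv s hs.1).symm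
  · have hm1 := hmpos 1 one_pos
    set C := lam / m 1 with hC
    have hC0 : 0 < C := div_pos hlam hm1
    have hCm : C * m 1 = lam := div_mul_cancel₀ _ hm1.ne'
    set M : ℝ → ℝ := fun x => ∫ r in (0:ℝ)..x, m r with hM
    have hMm := aux_prim_integrable m hm
    have hM0 : ∀ x > 0, 0 ≤ M x := fun x hx => by
      simp only [hM]
      rw [intervalIntegral.integral_of_le hx.le]
      exact setIntegral_nonneg measurableSet_Ioc fun s hs => (hmpos s hs.1).le
    have hMge : ∀ x > 0, m 1 ≤ m x + M x := by
      intro x hx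
      rcases le_or_gt x 1 with h | h
      · linarith [hanti hx (show (1:ℝ) ∈ Ioi 0 by simp) h, hM0 x hx]
      · have h1 : M 1 ≤ M x := by
          exact aux_prim_mono m x (fun s hs _ => aux_mii m hm 0 s le_rfl hs)
            (fun y hy _ => (hmpos y hy).le) ⟨zero_le_one, h.le⟩ ⟨hx.le, le_rfl⟩ h.le
        have h2 : m 1 ≤ M 1 := by
          have := intervalIntegral.integral_mono_on_of_le_Ioo (a := 0) (b := 1) (μ := volume)
            (f := fun _ => m 1) (g := m) zero_le_one (by simp)
            (aux_mii m hm 0 1 le_rfl zero_le_one)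
            (fun y hy => hanti hy.1 (show (1:ℝ) ∈ Ioi 0 by simp) hy.2.le)
          simpa using this
        linarith [hmpos x hx]
    refine ⟨C, hC0.le, fun t ht => ?_⟩
    have hZc : Continuous (fun s => 1 + C + C * s - Y s) := by fun_prop
    have i1 : ∀ s ≥ 0, IntervalIntegrable (fun x => (1 + C) * m x) volume 0 s :=
      fun s hs => (aux_mii m hm 0 s le_rfl hs).const_mul _
    have i2 : ∀ s ≥ 0, IntervalIntegrable (fun x => C * M x) volume 0 s :=
      fun s hs => (aux_mii M hMm 0 s le_rfl hs).const_mul _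
    have i3 : ∀ s ≥ 0, IntervalIntegrable kt volume 0 s :=
      fun s hs => aux_mii kt hkt 0 s le_rfl hs
    have hmono : MonotoneOn (auxConv m (fun s => 1 + C + C * s - Y s)) (Icc 0 t) := by
      have := aux_prim_mono (fun x => (1 + C) * m x + C * M x - kt x) t
        (fun s hs _ => ((i1 s hs).add (i2 s hs)).sub (i3 s hs))
        (fun x hx _ => by
          have e := hrel x hx
          have g := hMge x hx
          have g2 := mul_le_mul_of_nonneg_left g hC0.le
          have g3 := mul_nonneg hp₀.le (hM0 x hx)
          have e' : kt x = m x + lam - p₀ * M x := e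
          rw [e']
          linarith)
      refine this.congr fun s hs => ?_
      have j1 := aux_conv_ii m hm (fun _ => 1 + C) continuous_const s hs.1
      have j2 := (aux_conv_ii m hm (fun s => s) continuous_id s hs.1).const_mul C
      have j3 := aux_conv_ii m hm Y hY s hs.1
      have e1 : auxConv m (fun s => 1 + C + C * s - Y s) s
          = auxConv m (fun _ => 1 + C) s + C * auxConv m (fun s => s) s - auxConv m Y s := by
        unfold auxConv
        rw [← intervalIntegral.integral_const_mul, ← intervalIntegral.integral_add j1 j2,
          ← intervalIntegral.integral_sub (j1.add j2) j3]
        congr 1; ext s; ring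
      rw [e1, aux_conv_const, aux_conv_id m hm s hs.1, hconv s hs.1]
      show ∫ x in (0:ℝ)..s, ((1 + C) * m x + C * M x - kt x) = _
      rw [intervalIntegral.integral_sub ((i1 s hs.1).add (i2 s hs.1)) (i3 s hs.1),
        intervalIntegral.integral_add (i1 s hs.1) (i2 s hs.1),
        intervalIntegral.integral_const_mul, intervalIntegral.integral_const_mul]
    have := aux_mp m _ t hmpos hanti hm hZc hmono t ⟨ht, le_rfl⟩
    linarith

lemma aux_Y_decay (Y : ℝ → ℝ) (p₀ C : ℝ) (hp₀ : 0 < p₀) (hC : 0 ≤ C) (hY : Continuous Y)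
    (h0 : ∀ t > 0, 0 ≤ Y t) (h1 : ∀ t > 0, Y t ≤ 1 + C + C * t) :
    IntegrableOn (fun t => exp (-p₀ * t) * Y t) (Ioi 0) ∧
      Tendsto (fun t => exp (-p₀ * t) * Y t) atTop (nhds 0) := by
  set D := 1 + C + C * (2 / p₀) with hD
  have hb : ∀ t > 0, ‖exp (-p₀ * t) * Y t‖ ≤ D * exp (-(p₀ / 2) * t) := by
    intro t ht
    rw [norm_mul, Real.norm_of_nonneg (exp_pos _).le, Real.norm_of_nonneg (h0 t ht)]
    have a1 : exp (-(p₀ / 2) * t) = exp (-p₀ * t) * exp (p₀ / 2 * t) := by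
      rw [← Real.exp_add]; congr 1; ring
    have a2 : p₀ / 2 * t + 1 ≤ exp (p₀ / 2 * t) := add_one_le_exp _
    have a3 : t ≤ 2 / p₀ * exp (p₀ / 2 * t) := by
      have : t = 2 / p₀ * (p₀ / 2 * t) := by field_simp
      calc t = 2 / p₀ * (p₀ / 2 * t) := this
        _ ≤ _ := mul_le_mul_of_nonneg_left (by linarith) (by positivity)
    have a4 : (1:ℝ) ≤ exp (p₀ / 2 * t) := by
      have : 0 ≤ p₀ / 2 * t := by positivity
      linarith
    have a5 : Y t ≤ D * exp (p₀ / 2 * t) := by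
      have b1 := h1 t ht
      have b2 := mul_le_mul_of_nonneg_left a3 hC
      have b3 := mul_le_mul_of_nonneg_left a4 (show 0 ≤ 1 + C by linarith)
      rw [hD]
      nlinarith
    rw [a1]
    nlinarith [mul_le_mul_of_nonneg_left a5 (exp_pos (-p₀ * t)).le]
  constructor
  · have hi : IntegrableOn (fun t => D * exp (-(p₀ / 2) * t)) (Ioi 0) :=
      (exp_neg_integrableOn_Ioi 0 (half_pos hp₀)).const_mul D
    refine Integrable.mono' hi (by
      exact (Continuous.aestronglyMeasurable (by fun_prop))) ?_
    rw [ae_restrict_iff' measurableSet_Ioi]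
    exact Eventually.of_forall fun t ht => hb t ht
  · refine squeeze_zero_norm' (a := fun t => D * exp (-(p₀ / 2) * t)) ?_ ?_
    · filter_upwards [eventually_gt_atTop 0] with t ht using hb t ht
    · have : Tendsto (fun t : ℝ => -(p₀ / 2) * t) atTop atBot :=
        tendsto_id.const_mul_atTop_of_neg (by linarith)
      simpa using (tendsto_exp_atBot.comp this).const_mul D

lemma aux_laplace_conv (m v : ℝ → ℝ) (p : ℝ)
    (hm : IntegrableOn (fun t => exp (-p * t) * m t) (Ioi 0))
    (hv : IntegrableOn (fun t => exp (-p * t) * v t) (Ioi 0)) :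
    ∫ x in Ioi (0:ℝ), exp (-p * x) * auxConv m v x
      = (∫ x in Ioi (0:ℝ), exp (-p * x) * m x) * ∫ x in Ioi (0:ℝ), exp (-p * x) * v x := by
  have h := integral_posConvolution hv hm (ContinuousLinearMap.mul ℝ ℝ)
  rw [ContinuousLinearMap.mul_apply'] at h
  rw [mul_comm, ← h]
  congr 1; ext x
  unfold auxConv
  rw [← intervalIntegral.integral_const_mul]
  congr 1; ext s
  rw [ContinuousLinearMap.mul_apply',
    show exp (-p * x) = exp (-p * s) * exp (-p * (x - s)) by rw [← Real.exp_add]; congr 1; ring]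
  ring

lemma aux_laplace_Y (m kt Y : ℝ → ℝ) (p : ℝ) (hp : 0 < p)
    (hm : IntegrableOn (fun t => exp (-p * t) * m t) (Ioi 0))
    (hk : IntegrableOn (fun t => exp (-p * t) * kt t) (Ioi 0))
    (hY : IntegrableOn (fun t => exp (-p * t) * Y t) (Ioi 0))
    (hconv : ∀ t ≥ 0, auxConv m Y t = ∫ s in (0:ℝ)..t, kt s) :
    (∫ x in Ioi (0:ℝ), exp (-p * x) * m x) * (∫ x in Ioi (0:ℝ), exp (-p * x) * Y x)
      = (∫ x in Ioi (0:ℝ), exp (-p * x) * kt x) * (1 / p) := by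
  have h1 : IntegrableOn (fun t => exp (-p * t) * (fun _ => (1:ℝ)) t) (Ioi 0) := by
    simpa using exp_neg_integrableOn_Ioi 0 hp
  have e1 : ∫ x in Ioi (0:ℝ), exp (-p * x) * (fun _ => (1:ℝ)) x = 1 / p := by
    have := integral_exp_mul_Ioi (a := -p) (by linarith) 0
    simp only [mul_one]
    rw [this]
    simp
  rw [← aux_laplace_conv m Y p hm hY, ← e1, ← aux_laplace_conv kt _ p hk h1]
  refine setIntegral_congr_fun measurableSet_Ioi fun x hx => ?_
  rw [hconv x (le_of_lt hx), aux_conv_const, one_mul]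

lemma aux_limit (U Y : ℝ → ℝ) (p : ℝ) (hU : Continuous U)
    (hYdef : ∀ t, Y t = U t - p * ∫ r in (0:ℝ)..t, U r)
    (hYi : IntegrableOn (fun t => exp (-p * t) * Y t) (Ioi 0))
    (hY0 : Tendsto (fun t => exp (-p * t) * Y t) atTop (nhds 0)) :
    Tendsto (fun t => exp (-p * t) * U t) atTop
      (nhds (p * ∫ x in Ioi (0:ℝ), exp (-p * x) * Y x)) := by
  set I : ℝ → ℝ := fun x => ∫ r in (0:ℝ)..x, U r with hI
  have hId : ∀ t, HasDerivAt I (U t) t := fun t =>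
    intervalIntegral.integral_hasDerivAt_right (hU.intervalIntegrable _ _)
      hU.stronglyMeasurable.stronglyMeasurableAtFilter hU.continuousAt
  have hIc : Continuous I := continuous_iff_continuousAt.2 fun t => (hId t).continuousAt
  have hYc : Continuous Y := by
    rw [show Y = fun t => U t - p * I t from funext hYdef]
    fun_prop
  have hd : ∀ t, HasDerivAt (fun t => exp (-p * t) * I t) (exp (-p * t) * Y t) t := by
    intro t
    have h1 : HasDerivAt (fun t => exp (-p * t)) (exp (-p * t) * (-p * 1)) t :=
      ((hasDerivAt_id t).const_mul (-p)).exp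
    have h2 := h1.mul (hId t)
    rw [show exp (-p * t) * Y t = exp (-p * t) * (-p * 1) * I t + exp (-p * t) * U t by
      rw [hYdef]; simp only [hI]; ring]
    exact h2
  have hEq : ∀ t, exp (-p * t) * I t = ∫ s in (0:ℝ)..t, exp (-p * s) * Y s := by
    intro t
    rw [intervalIntegral.integral_eq_sub_of_hasDerivAt (fun x _ => hd x)
      (Continuous.intervalIntegrable (by fun_prop) _ _)]
    simp [hI]
  have hl := intervalIntegral_tendsto_integral_Ioi 0 hYi tendsto_id
  have := hY0.add (hl.const_mul p)
  rw [zero_add] at this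
  refine this.congr fun t => ?_
  simp only [id]
  rw [← hEq t, hYdef]
  simp only [hI]
  ring

/-- Main Theorem: under assumptions (*) and ∫₁^∞ ds/(sΦ(s)) < ∞, the solution
of the growth equation D_{(k)} u = λ u, u(0) = 1 satisfies
u(t) = (λ/(Φ'(p₀)p₀)) e^{p₀t} + o(e^{p₀t}) as t → ∞, where Φ(p₀) = λ, p₀ > 0. -/
theorem stmt_17 (σ : Measure ℝ) (hsupp : σ (Iio 0) = 0)
    (hσint : Integrable (fun t : ℝ => (1 + t)⁻¹) σ)
    (k : ℝ → ℝ) (hknn : ∀ t > 0, 0 ≤ k t) (hkloc : LocallyIntegrableOn k (Ioi 0))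
    (𝒦 : ℝ → ℝ)
    (h𝒦 : ∀ p > 0, 𝒦 p = ∫ t in Ioi (0:ℝ), Real.exp (-p * t) * k t)
    (hSt : ∀ p > 0, 𝒦 p = ∫ t : ℝ, (p + t)⁻¹ ∂σ)
    (Φ : ℝ → ℝ) (hΦ : ∀ p, Φ p = p * 𝒦 p)
    (h𝒦0 : Tendsto 𝒦 (nhdsWithin 0 (Ioi 0)) atTop)
    (h𝒦inf : Tendsto 𝒦 atTop (nhds 0))
    (hΦ0 : Tendsto Φ (nhdsWithin 0 (Ioi 0)) (nhds 0))
    (hΦinf : Tendsto Φ atTop atTop)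
    (hint : IntegrableOn (fun s : ℝ => (s * Φ s)⁻¹) (Ioi 1))
    (lam : ℝ) (hlam : 0 < lam) (p₀ : ℝ) (hp₀ : 0 < p₀) (hΦp₀ : Φ p₀ = lam)
    (u : ℝ → ℝ) (hu0 : u 0 = 1) (huc : ContinuousOn u (Ici 0))
    (hode : ∀ t > 0, genFracDeriv k u t = lam * u t) :
    (fun t => u t - (lam / (deriv Φ p₀ * p₀)) * Real.exp (p₀ * t))
      =o[atTop] fun t => Real.exp (p₀ * t) := by
  have : SigmaFinite σ := aux_sigmaFinite σ hsupp hσint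
  have h0 : ∀ᵐ t ∂σ, 0 ≤ t := aux_ae_nonneg σ hsupp
  have hΦ' : ∀ p > 0, Φ p = p * ∫ t, (p + t)⁻¹ ∂σ := fun p hp => by rw [hΦ, hSt p hp]
  set kt : ℝ → ℝ := fun x => ∫ t, exp (-x * t) * 1 ∂σ with hktdef
  set m : ℝ → ℝ := fun x => ∫ t, exp (-x * t) * (t / (p₀ + t)) ∂σ with hmdef
  have hgm : Measurable (fun t : ℝ => t / (p₀ + t)) :=
    measurable_id.div (measurable_const.add measurable_id)
  have hg0 : ∀ t : ℝ, 0 ≤ t → 0 ≤ t / (p₀ + t) := fun t ht => by positivity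
  have hg1 : ∀ t : ℝ, 0 ≤ t → t / (p₀ + t) ≤ 1 := fun t ht => by
    rw [div_le_one (by linarith)]; linarith
  have hmS := aux_stieltjes σ h0 hσint (fun t => t / (p₀ + t)) hgm hg0 hg1
  have hkS := aux_stieltjes σ h0 hσint (fun _ => 1) measurable_const (fun _ _ => zero_le_one)
    (fun _ _ => le_rfl)
  have hmanti : AntitoneOn m (Ioi 0) := aux_antitone σ h0 hσint _ hgm hg0 hg1
  have hktanti : AntitoneOn kt (Ioi 0) := aux_antitone σ h0 hσint (fun _ => 1) measurable_const
    (fun _ _ => zero_le_one) (fun _ _ => le_rfl)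
  have hmpos : ∀ x > 0, 0 < m x := aux_pos σ h0 hσint Φ hΦ' hΦinf p₀ hp₀
  have hktpos : ∀ x > 0, 0 < kt x := by
    intro x hx
    refine lt_of_lt_of_le (hmpos x hx) ?_
    refine integral_mono_of_nonneg ?_ ?_ ?_
    · filter_upwards [h0] with t ht
      exact mul_nonneg (exp_pos _).le (hg0 t ht)
    · simpa using aux_exp_int σ h0 hσint x hx
    · filter_upwards [h0] with t ht
      exact mul_le_mul_of_nonneg_left (hg1 t ht) (exp_pos _).le
  have hmint : ∀ t, IntegrableOn m (Ioc 0 t) := aux_loc m (hmS 1 one_pos).1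
  have hktint : ∀ t, IntegrableOn kt (Ioc 0 t) := aux_loc kt (hkS 1 one_pos).1
  have hrel : ∀ x > 0, kt x = m x + lam - p₀ * ∫ y in (0:ℝ)..x, m y := by
    intro x hx
    have := aux_relation σ h0 hσint p₀ hp₀ x hx
    rw [← hΦ' p₀ hp₀, hΦp₀] at this
    simpa [hktdef, hmdef] using this
  have hktL : ∀ p > 0, ∫ x in Ioi (0:ℝ), exp (-p * x) * kt x = 𝒦 p := by
    intro p hp
    rw [hSt p hp, (hkS p hp).2]
    simp
  have h𝒦pos : ∀ p > 0, 𝒦 p ≠ 0 := by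
    intro p hp hz
    rw [hSt p hp, integral_eq_zero_iff_of_nonneg_ae] at hz
    · have hF : ∀ᵐ t ∂σ, False := by
        filter_upwards [hz, h0] with t h1 h2
        have : (p + t)⁻¹ = 0 := h1
        rw [inv_eq_zero] at this
        linarith
      have hσ0 : σ = 0 := by
        rw [← Measure.measure_univ_eq_zero]
        simpa [ae_iff] using hF
      have := hmpos 1 one_pos
      simp only [hmdef, hσ0, integral_zero_measure] at this
      exact lt_irrefl _ this
    · filter_upwards [h0] with t ht
      exact inv_nonneg.2 (by linarith)
    · exact aux_inv_int σ h0 hσint p hp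
  have hkL : ∀ p > 0, IntegrableOn (fun t => exp (-p * t) * k t) (Ioi 0) := by
    intro p hp
    by_contra hn
    refine h𝒦pos p hp ?_
    rw [h𝒦 p hp]
    exact integral_undef hn
  have hkint : ∀ t, IntegrableOn k (Ioc 0 t) := aux_loc k (hkL 1 one_pos)
  have hkk : k =ᵐ[volume.restrict (Ioi 0)] kt :=
    aux_laplace_unique k kt hknn (fun t ht => (hktpos t ht).le) hkL (fun p hp => (hkS p hp).1)
      (fun p hp => by rw [hktL p hp, h𝒦 p hp])
  set U : ℝ → ℝ := fun s => u (max s 0) with hUdef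
  have hU : Continuous U := by
    refine huc.comp_continuous (continuous_id.max continuous_const) fun s => ?_
    exact le_max_right s (0:ℝ)
  have hUu : ∀ t ≥ 0, U t = u t := fun t ht => by simp only [hUdef]; rw [max_eq_left ht]
  have hUpos := aux_solution_pos k kt U u hknn hkint hkk hktint hktpos hktanti hU hUu lam hlam
    hu0 hode
  have hconv : ∀ t ≥ 0,
      auxConv kt U t = (∫ s in (0:ℝ)..t, kt s) + lam * ∫ s in (0:ℝ)..t, U s := by
    intro t ht
    have h1 := aux_integrated k U u hknn hkint hU hUu lam hlam hu0 hode t ht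
      (fun s hs => hUpos s hs.1)
    have h2 : ∫ s in (0:ℝ)..t, k s = ∫ s in (0:ℝ)..t, kt s := by
      refine intervalIntegral.integral_congr_ae ?_
      have hkk' := hkk
      rw [Filter.EventuallyEq, ae_restrict_iff' measurableSet_Ioi] at hkk'
      filter_upwards [hkk'] with s hs hst
      rw [uIoc_of_le ht] at hst
      exact hs hst.1
    rw [← aux_conv_congr k kt U hkk t ht, h1, h2]
  set Y : ℝ → ℝ := fun s => U s - p₀ * ∫ r in (0:ℝ)..s, U r with hYdef
  have hYc : Continuous Y := hU.sub (continuous_const.mul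
    (intervalIntegral.continuous_primitive (fun a b => hU.intervalIntegrable a b) 0))
  have hYconv : ∀ t ≥ 0, auxConv m Y t = ∫ s in (0:ℝ)..t, kt s := fun t ht =>
    aux_Y m kt U lam p₀ hmint hrel hU t ht (hconv t ht)
  obtain ⟨hY0, C, hC, hY1⟩ := aux_Y_bounds m kt Y lam p₀ hlam hp₀ hmint hktint hmpos hktpos hmanti
    hrel hYc hYconv
  obtain ⟨hYi, hYlim⟩ := aux_Y_decay Y p₀ C hp₀ hC hYc hY0 hY1
  have hprod := aux_laplace_Y m kt Y p₀ hp₀ (hmS p₀ hp₀).1 (hkS p₀ hp₀).1 hYi hYconv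
  have hlim := aux_limit U Y p₀ hU (fun t => rfl) hYi hYlim
  have hS : ∫ x in Ioi (0:ℝ), exp (-p₀ * x) * m x = deriv Φ p₀ := by
    rw [(aux_hasDeriv σ h0 hσint Φ hΦ' p₀ hp₀).deriv]
    exact (hmS p₀ hp₀).2
  have hK0 : p₀ * 𝒦 p₀ = lam := by rw [← hΦ, hΦp₀]
  rw [hS, hktL p₀ hp₀] at hprod
  have hSne : deriv Φ p₀ ≠ 0 := by
    intro hz
    rw [hz, zero_mul] at hprod
    have := mul_ne_zero (h𝒦pos p₀ hp₀) (one_div_ne_zero hp₀.ne')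
    exact this hprod.symm
  have hval : p₀ * ∫ x in Ioi (0:ℝ), exp (-p₀ * x) * Y x = lam / (deriv Φ p₀ * p₀) := by
    rw [eq_div_iff (mul_ne_zero hSne hp₀.ne')]
    calc _ = p₀ * p₀ * (deriv Φ p₀ * ∫ x in Ioi (0:ℝ), exp (-p₀ * x) * Y x) := by ring
      _ = lam := by rw [hprod, ← hK0]; field_simp
  rw [hval] at hlim
  rw [isLittleO_iff_tendsto' (Eventually.of_forall fun t h => absurd h (exp_ne_zero _))]
  have hfin := hlim.sub_const (lam / (deriv Φ p₀ * p₀))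
  rw [sub_self] at hfin
  refine hfin.congr' ?_
  filter_upwards [eventually_ge_atTop 0] with t ht
  rw [hUu t ht, sub_div, mul_div_cancel_right₀ _ (exp_ne_zero _), neg_mul, Real.exp_neg,
    div_eq_inv_mul (u t)]
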